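/- Let p > 3 be a prime and j ≥ 1 an integer with j not divisible by (p − 1)/2. Then for all integers m ≥ 1 and r ≥ 1, the p-adic valuation of the rational number S_{2j−1}(m·p^r) is at least 2r (i.e., S_{2j−1}(m·p^r) ≡ 0 (mod p^(2r)) in the p-adic sense). -/

import Mathlib

/-- `S_j(k) = ∑_{1 ≤ i ≤ k, p ∤ i} 1 / i^j` as a rational number. -/
def Ssum (p j k : ℕ) : ℚ :=
  ∑ i ∈ (Finset.Icc 1 k).filter (fun i => ¬ p ∣ i), 1 / (i : ℚ) ^ j

lemma Ring.inverse_map_of_isUnit {R S : Type*} [Semiring R] [Semiring S] (f : R →+* S) {x : R}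
    (hx : IsUnit x) : f (Ring.inverse x) = Ring.inverse (f x) := by
  obtain ⟨u, rfl⟩ := hx
  rw [Ring.inverse_unit]
  exact (Ring.inverse_unit (Units.map (f : R →* S) u)).symm

lemma sq_dvd_inverse_pow_add_inverse_pow {R : Type*} [CommRing R] {x u N v : R} {n : ℕ}
    (hu : x * u = 1) (hv : (N - x) * v = 1) (hn : Odd n) :
    N ^ 2 ∣ u ^ n + v ^ n + n * N * u ^ (n + 1) := by
  obtain ⟨l, rfl⟩ := hn
  have huv : u + v = N * u * v := by linear_combination -u * hv - v * hu
  obtain ⟨k, hk⟩ := Polynomial.powAddExpansion (-u) (u + v) (2 * l + 1)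
  rw [neg_add_cancel_left, Odd.neg_pow ⟨l, rfl⟩, Nat.add_sub_cancel, Even.neg_pow ⟨l, two_mul l⟩]
    at hk
  refine ⟨(2 * l + 1 : ℕ) * u ^ (2 * l + 2) * v + k * (u * v) ^ 2, ?_⟩
  rw [hk]
  have hsq : (u + v) ^ 2 = N ^ 2 * (u * v) ^ 2 := by rw [huv]; ring
  have hlin : u + v = -N * u ^ 2 + N ^ 2 * u ^ 2 * v := by
    linear_combination (1 + N * u) * huv
  rw [hsq, hlin]
  ring

lemma ZMod.sum_range_mul_natCast {M : Type*} [AddCommMonoid M] (n : ℕ) [NeZero n]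
    (f : ZMod n → M) (m : ℕ) :
    ∑ i ∈ Finset.range (m * n), f i = m • ∑ x, f x := by
  have hperiod : ∑ i ∈ Finset.range n, f i = ∑ x, f x := by
    refine Finset.sum_nbij' (fun i => (i : ZMod n)) ZMod.val (by simp)
      (fun x _ => Finset.mem_range.2 x.val_lt)
      (fun i hi => ZMod.val_cast_of_lt (Finset.mem_range.1 hi)) (by simp) (by simp)
  induction m with
  | zero => simp
  | succ m ih => simp [add_mul, Finset.sum_range_add, ih, hperiod, succ_nsmul]

lemma ZMod.sum_inverse_pow_eq_zero (p : ℕ) [Fact p.Prime] (r k : ℕ) (hk : ¬ p - 1 ∣ k) :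
    ∑ x : ZMod (p ^ r), Ring.inverse x ^ k = 0 := by
  obtain ⟨g, hg⟩ : ∃ g : (ZMod p)ˣ, g ^ k ≠ 1 := by
    have := FiniteField.forall_pow_eq_one_iff (ZMod p) k
    rw [ZMod.card] at this
    by_contra! h
    exact hk (this.1 h)
  set a : ℕ := (g : ZMod p).val
  have hag : (a : ZMod p) = g := ZMod.natCast_zmod_val _
  have ha_unit : IsUnit (a : ZMod (p ^ r)) :=
    (ZMod.isUnit_iff_coprime _ _).2 ((ZMod.val_coe_unit_coprime g).pow_right r)
  have hsub_unit : IsUnit (((a : ℤ) ^ k - 1 : ℤ) : ZMod (p ^ r)) := by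
    rw [ZMod.coe_int_isUnit_iff_isCoprime, Nat.cast_pow]
    refine IsCoprime.pow_left ?_
    rw [← ZMod.coe_int_isUnit_iff_isCoprime, isUnit_iff_ne_zero]
    push_cast
    rw [hag, sub_ne_zero]
    rwa [← Units.val_pow_eq_pow_val, Ne, Units.val_eq_one]
  push_cast at hsub_unit
  obtain ⟨b, hb⟩ := ha_unit
  rw [← hb] at hsub_unit
  have hscale : ∑ x : ZMod (p ^ r), Ring.inverse x ^ k
      = Ring.inverse (b : ZMod (p ^ r)) ^ k * ∑ x : ZMod (p ^ r), Ring.inverse x ^ k := by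
    conv_lhs => rw [← Equiv.sum_comp (Units.mulLeft b)]
    simp_rw [Units.mulLeft_apply, Ring.mul_inverse_rev, mul_pow]
    rw [← Finset.sum_mul, mul_comm]
  refine hsub_unit.mul_right_eq_zero.1 ?_
  have hcancel : (b : ZMod (p ^ r)) ^ k * Ring.inverse (b : ZMod (p ^ r)) ^ k = 1 := by
    rw [← mul_pow, Ring.mul_inverse_cancel _ b.isUnit, one_pow]
  linear_combination (b : ZMod (p ^ r)) ^ k * hscale +
    (∑ x : ZMod (p ^ r), Ring.inverse x ^ k) * hcancel

lemma PadicInt.isUnit_natCast_iff_not_dvd {p : ℕ} [hp : Fact p.Prime] {i : ℕ} :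
    IsUnit (i : ℤ_[p]) ↔ ¬ p ∣ i := by
  rw [PadicInt.isUnit_iff, PadicInt.norm_natCast_eq_one_iff, hp.out.coprime_iff_not_dvd]

lemma PadicInt.pow_dvd_sum_inverse_pow {p : ℕ} [hp : Fact p.Prime] {m r k : ℕ} (hr : r ≠ 0)
    (hk : ¬ p - 1 ∣ k) :
    (p : ℤ_[p]) ^ r ∣
      ∑ i ∈ (Finset.Icc 1 (m * p ^ r)).filter (fun i => ¬ p ∣ i),
        Ring.inverse (i : ℤ_[p]) ^ k := by
  have hk0 : k ≠ 0 := by rintro rfl; exact hk (dvd_zero _)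
  have hpN : p ∣ m * p ^ r := (dvd_pow_self p hr).mul_left m
  rw [← Ideal.mem_span_singleton, ← PadicInt.ker_toZModPow, RingHom.mem_ker]
  have hset : (Finset.Icc 1 (m * p ^ r)).filter (fun i => ¬ p ∣ i)
      = (Finset.range (m * p ^ r)).filter (fun i => ¬ p ∣ i) := by
    ext i
    simp only [Finset.mem_filter, Finset.mem_Icc, Finset.mem_range, and_congr_left_iff]
    intro hi
    have hi0 : i ≠ 0 := by rintro rfl; exact hi (dvd_zero _)
    have hiN : i ≠ m * p ^ r := by rintro rfl; exact hi hpN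
    omega
  have hzero := ZMod.sum_range_mul_natCast (p ^ r) (fun x => Ring.inverse x ^ k) m
  rw [ZMod.sum_inverse_pow_eq_zero p r k hk, smul_zero] at hzero
  rw [hset, Finset.sum_filter, map_sum, ← hzero]
  refine Finset.sum_congr rfl fun i _ => ?_
  by_cases hi : p ∣ i
  · rw [if_neg (not_not.2 hi), map_zero, Ring.inverse_non_unit, zero_pow hk0]
    rwa [ZMod.isUnit_iff_coprime, Nat.coprime_pow_right_iff (Nat.pos_of_ne_zero hr),
      Nat.coprime_comm, hp.out.coprime_iff_not_dvd, not_not]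
  · rw [if_pos hi, map_pow, Ring.inverse_map_of_isUnit _ (PadicInt.isUnit_natCast_iff_not_dvd.2 hi),
      map_natCast]

lemma PadicInt.pow_dvd_sum_inverse_odd_pow {p : ℕ} [hp : Fact p.Prime] (hp2 : p ≠ 2)
    {m r n : ℕ} (hr : r ≠ 0) (hn : Odd n) (hk : ¬ p - 1 ∣ n + 1) :
    (p : ℤ_[p]) ^ (2 * r) ∣
      ∑ i ∈ (Finset.Icc 1 (m * p ^ r)).filter (fun i => ¬ p ∣ i),
        Ring.inverse (i : ℤ_[p]) ^ n := by
  set N := m * p ^ r with hN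
  have hpN : p ∣ N := (dvd_pow_self p hr).mul_left m
  have hprN : (p : ℤ_[p]) ^ r ∣ (N : ℤ_[p]) := ⟨m, by rw [hN]; push_cast; ring⟩
  set A := (Finset.Icc 1 N).filter (fun i => ¬ p ∣ i) with hA
  have hmem : ∀ i ∈ A, i ≤ N ∧ ¬ p ∣ i ∧ N - i ∈ A := by
    intro i hi
    simp only [hA, Finset.mem_filter, Finset.mem_Icc] at hi ⊢
    have hiN : i ≠ N := by rintro rfl; exact hi.2 hpN
    refine ⟨hi.1.2, hi.2, by omega, fun h => hi.2 ?_⟩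
    exact (Nat.dvd_sub_iff_right hi.1.2 hpN).1 h
  have hreflect : ∑ i ∈ A, Ring.inverse ((N - i : ℕ) : ℤ_[p]) ^ n
      = ∑ i ∈ A, Ring.inverse (i : ℤ_[p]) ^ n := by
    refine Finset.sum_nbij' (fun i => N - i) (fun i => N - i) (fun i hi => (hmem i hi).2.2)
      (fun i hi => (hmem i hi).2.2) (fun i hi => Nat.sub_sub_self (hmem i hi).1)
      (fun i hi => Nat.sub_sub_self (hmem i hi).1) (fun _ _ => rfl)
  have hpairs : (p : ℤ_[p]) ^ (2 * r) ∣ ∑ i ∈ A, (Ring.inverse (i : ℤ_[p]) ^ n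
      + Ring.inverse ((N - i : ℕ) : ℤ_[p]) ^ n + n * N * Ring.inverse (i : ℤ_[p]) ^ (n + 1)) := by
    refine Finset.dvd_sum fun i hi => ?_
    obtain ⟨hiN, hpi, hi'⟩ := hmem i hi
    have hpi' := (hmem _ hi').2.1
    refine dvd_trans ?_ (sq_dvd_inverse_pow_add_inverse_pow (x := (i : ℤ_[p])) (N := (N : ℤ_[p]))
      (Ring.mul_inverse_cancel _ (PadicInt.isUnit_natCast_iff_not_dvd.2 hpi)) ?_ hn)
    · rw [mul_comm, pow_mul]
      exact pow_dvd_pow_of_dvd hprN 2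
    · rw [← Nat.cast_sub hiN]
      exact Ring.mul_inverse_cancel _ (PadicInt.isUnit_natCast_iff_not_dvd.2 hpi')
  rw [Finset.sum_add_distrib, Finset.sum_add_distrib, hreflect, ← Finset.mul_sum, ← two_mul]
    at hpairs
  have hcorrection : (p : ℤ_[p]) ^ (2 * r) ∣
      n * N * ∑ i ∈ A, Ring.inverse (i : ℤ_[p]) ^ (n + 1) := by
    rw [two_mul, pow_add]
    exact mul_dvd_mul (hprN.mul_left _) (PadicInt.pow_dvd_sum_inverse_pow hr hk)
  have htwo : IsUnit (2 : ℤ_[p]) := by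
    have h := PadicInt.isUnit_natCast_iff_not_dvd (p := p) (i := 2)
    rw [Nat.cast_ofNat] at h
    exact h.2 fun h2 => hp2 ((Nat.prime_dvd_prime_iff_eq hp.out Nat.prime_two).1 h2)
  exact htwo.dvd_mul_left.1 ((dvd_add_left hcorrection).1 hpairs)

lemma PadicInt.coe_sum_inverse_pow {p : ℕ} [Fact p.Prime] (n k : ℕ) :
    ((∑ i ∈ (Finset.Icc 1 k).filter (fun i => ¬ p ∣ i),
      Ring.inverse (i : ℤ_[p]) ^ n : ℤ_[p]) : ℚ_[p]) = (Ssum p n k : ℚ) := by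
  rw [Ssum, PadicInt.coe_sum]
  push_cast
  refine Finset.sum_congr rfl fun i hi => ?_
  have hunit := PadicInt.isUnit_natCast_iff_not_dvd.2 (Finset.mem_filter.1 hi).2
  have hmul := congrArg (PadicInt.Coe.ringHom (p := p)) (Ring.mul_inverse_cancel _ hunit)
  rw [map_mul, map_one, map_natCast] at hmul
  rw [one_div, ← inv_pow, ← eq_inv_of_mul_eq_one_right hmul]
  rfl

/-- Coster's Lemma: `S_{2j-1}(m p^r) ≡ 0 (mod p^{2r})` when `((p-1)/2) ∤ j`,
i.e. the `p`-adic norm of `S_{2j-1}(m p^r)` is at most `p^(-2r)`. -/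
theorem Ssum_odd_padic_congruence (p : ℕ) (hp : p.Prime) (hp3 : 3 < p)
    (j : ℕ) (hj : 1 ≤ j) (hjd : ¬ ((p - 1) / 2) ∣ j)
    (m r : ℕ) (hm : 1 ≤ m) (hr : 1 ≤ r) :
    padicNorm p (Ssum p (2 * j - 1) (m * p ^ r)) ≤ (p : ℚ) ^ (-(2 * r : ℤ)) := by
  have : Fact p.Prime := ⟨hp⟩
  have hk : ¬ p - 1 ∣ 2 * j - 1 + 1 := by
    obtain ⟨q, hq⟩ := hp.odd_of_ne_two (by omega)
    rw [show 2 * j - 1 + 1 = 2 * j by omega, show p - 1 = 2 * q by omega,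
      Nat.mul_dvd_mul_iff_left two_pos]
    rwa [show (p - 1) / 2 = q by omega] at hjd
  have hdvd := PadicInt.pow_dvd_sum_inverse_odd_pow (p := p) (m := m) (r := r) (by omega)
    (by omega) (⟨j - 1, by omega⟩ : Odd (2 * j - 1)) hk
  rw [← Ideal.mem_span_singleton, ← PadicInt.norm_le_pow_iff_mem_span_pow, PadicInt.norm_def,
    PadicInt.coe_sum_inverse_pow, Padic.eq_padicNorm] at hdvd
  rw [← Rat.cast_le (K := ℝ)]
  push_cast at hdvd ⊢
  exact hdvd
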